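/- arXiv:2202.08522 — 4 statements merged into one kernel-verified Lean document; each statement's English description precedes it below -/
import Mathlib

section
/- There exist absolute constants C₀ > 0 and n₀ such that for all n ≥ n₀, all k ≥ 1, and all 0 < q < p ≤ 3/4 with σ² ≥ C₀·log n/n, the following holds. There exists a (measurable) estimator f mapping each graph on an n-vertex set V to a subset of V such that for every hidden partition V = V₁ ∪ ⋯ ∪ V_k whose largest cluster size s_max satisfies s_max ≥ s̄, with probability at least 1 − 1/n² over a graph G sampled from SBM(n,k,p,q), the output f(G) is exactly equal to one of the clusters V_i, and this cluster has size |V_i| ≥ s_max/7. -/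
open MeasureTheory

/-- Bernoulli measure on `Bool` with success probability `p`. -/
noncomputable def bern (p : ℝ) : Measure Bool :=
  ENNReal.ofReal p • Measure.dirac true + ENNReal.ofReal (1 - p) • Measure.dirac false

/-- The stochastic block model measure: a random graph on `Fin n` (encoded as a function from
ordered pairs `u < v` to `Bool`), where an edge is present with probability `p` if both endpoints
lie in the same cluster of the partition `c` and with probability `q` otherwise, independently. -/
noncomputable def sbm (n k : ℕ) (c : Fin n → Fin k) (p q : ℝ) :
    Measure ({e : Fin n × Fin n // e.1 < e.2} → Bool) :=
  Measure.pi fun e => bern (if c e.1.1 = c e.1.2 then p else q)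

/-- The cluster `V_i` of the hidden partition `c`. -/
def clusterF {n k : ℕ} (c : Fin n → Fin k) (i : Fin k) : Finset (Fin n) :=
  Finset.univ.filter fun v => c v = i

/-- The size of the largest cluster. -/
def smax {n k : ℕ} (c : Fin n → Fin k) : ℕ :=
  Finset.univ.sup fun i : Fin k => (clusterF c i).card

/-- `σ := max(√(p(1−p)), √(q(1−q)))`. -/
noncomputable def sigSBM (p q : ℝ) : ℝ :=
  max (Real.sqrt (p * (1 - p))) (Real.sqrt (q * (1 - q)))

/-- `s̄ := 2^13·√(p(1−q)·n)·log n/(p−q)`. -/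
noncomputable def sbar (n : ℕ) (p q : ℝ) : ℝ :=
  2 ^ 13 * Real.sqrt (p * (1 - q) * n) * Real.log n / (p - q)

theorem isProbabilityMeasure_bern {r : ℝ} (h0 : 0 ≤ r) (h1 : r ≤ 1) :
    IsProbabilityMeasure (bern r) := by
  constructor
  simp only [bern, Measure.coe_add, Measure.coe_smul, Pi.add_apply, Pi.smul_apply, measure_univ,
    smul_eq_mul, mul_one]
  rw [← ENNReal.ofReal_add h0 (by linarith)]
  simp

theorem lintegral_bern_ofReal_exp {r : ℝ} (h0 : 0 ≤ r) (h1 : r ≤ 1) (y : Bool → ℝ) :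
    ∫⁻ b, ENNReal.ofReal (Real.exp (y b)) ∂(bern r) =
      ENNReal.ofReal (r * Real.exp (y true) + (1 - r) * Real.exp (y false)) := by
  rw [bern, lintegral_add_measure, lintegral_smul_measure, lintegral_smul_measure,
    lintegral_dirac, lintegral_dirac, smul_eq_mul, smul_eq_mul, ← ENNReal.ofReal_mul h0,
    ← ENNReal.ofReal_mul (by linarith), ← ENNReal.ofReal_add (by positivity)
      (mul_nonneg (by linarith) (Real.exp_pos _).le)]

/-- Chernoff bound for a sum of independent functions of Bernoulli variables. -/
theorem measure_pi_bern_sum_nonneg_le {ι : Type*} [Fintype ι] {r : ι → ℝ}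
    (h0 : ∀ e, 0 ≤ r e) (h1 : ∀ e, r e ≤ 1) (E : Finset ι) (y : Bool → ℝ) {B : ℝ} (hB : 0 ≤ B)
    (hE : ∀ e ∈ E, r e * Real.exp (y true) + (1 - r e) * Real.exp (y false) ≤ B) :
    Measure.pi (fun e => bern (r e)) {G | 0 ≤ ∑ e ∈ E, y (G e)} ≤ ENNReal.ofReal (B ^ E.card) := by
  have (e : ι) : IsProbabilityMeasure (bern (r e)) := isProbabilityMeasure_bern (h0 e) (h1 e)
  set μ := Measure.pi (fun e => bern (r e))
  have hind : ProbabilityTheory.iIndepFun (fun e (G : ι → Bool) => ENNReal.ofReal (Real.exp (y (G e)))) μ :=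
    ProbabilityTheory.iIndepFun_pi (X := fun _ b => ENNReal.ofReal (Real.exp (y b)))
      fun _ => (Measurable.of_discrete).aemeasurable
  have hmeas (e : ι) :
      Measurable (fun G : ι → Bool => ENNReal.ofReal (Real.exp (y (G e)))) :=
    Measurable.of_discrete
  calc μ {G | 0 ≤ ∑ e ∈ E, y (G e)}
      ≤ μ {G | 1 ≤ ∏ e ∈ E, ENNReal.ofReal (Real.exp (y (G e)))} := by
        refine measure_mono fun G hG => ?_
        simp only [Set.mem_ofPred_eq] at hG ⊢
        rw [← ENNReal.ofReal_prod_of_nonneg fun _ _ => (Real.exp_pos _).le, ← Real.exp_sum,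
          ENNReal.one_le_ofReal]
        exact Real.one_le_exp hG
    _ ≤ ∫⁻ G, ∏ e ∈ E, ENNReal.ofReal (Real.exp (y (G e))) ∂μ := by
        simpa using mul_meas_ge_le_lintegral (μ := μ)
          (f := fun G => ∏ e ∈ E, ENNReal.ofReal (Real.exp (y (G e)))) Measurable.of_discrete 1
    _ = ∏ e ∈ E, ∫⁻ b, ENNReal.ofReal (Real.exp (y b)) ∂(bern (r e)) := by
        rw [ProbabilityTheory.lintegral_prod_eq_prod_lintegral_of_indepFun E _ hind hmeas]
        refine Finset.prod_congr rfl fun e _ => ?_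
        exact (measurePreserving_eval (fun e => bern (r e)) e).lintegral_comp
          (f := fun b => ENNReal.ofReal (Real.exp (y b))) Measurable.of_discrete
    _ ≤ ∏ _e ∈ E, ENNReal.ofReal B := by
        refine Finset.prod_le_prod' fun e he => ?_
        rw [lintegral_bern_ofReal_exp (h0 e) (h1 e)]
        exact ENNReal.ofReal_le_ofReal (hE e he)
    _ = ENNReal.ofReal (B ^ E.card) := by
        rw [Finset.prod_const, ENNReal.ofReal_pow hB]

/-- Exponential moment of a Bernoulli(`q`) variable centred at `(p + q) / 2`, for the tilt
`δ / (2p)` with `δ = (p - q) / 2`. -/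
theorem bern_exp_moment_upper_le {p q δ : ℝ} (hq : 0 ≤ q) (hδ : 0 < δ) (hqp : q + 2 * δ = p) :
    q * Real.exp (δ / (2 * p) * (1 - (p + q) / 2)) +
      (1 - q) * Real.exp (δ / (2 * p) * (0 - (p + q) / 2)) ≤ Real.exp (-(δ ^ 2 / (4 * p))) := by
  have hp : 0 < p := by linarith
  set l := δ / (2 * p) with hl
  have hl0 : 0 < l := by positivity
  have hl1 : l ≤ 1 := by rw [hl, div_le_one (by positivity)]; linarith
  have hlp : l * p = δ / 2 := by rw [hl]; field_simp
  have h := (abs_le.mp (Real.abs_exp_sub_one_sub_id_le (x := l) (by rwa [abs_of_pos hl0]))).2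
  have hpδ : δ ^ 2 / (4 * p) = l * δ / 2 := by rw [hl]; field_simp; ring
  calc _ = Real.exp (-(l * ((p + q) / 2))) * (q * (Real.exp l - 1) + 1) := by
        rw [show l * (1 - (p + q) / 2) = -(l * ((p + q) / 2)) + l by ring,
          show l * (0 - (p + q) / 2) = -(l * ((p + q) / 2)) by ring, Real.exp_add]
        ring
    _ ≤ Real.exp (-(l * ((p + q) / 2))) * Real.exp (q * (Real.exp l - 1)) := by
        gcongr; exact Real.add_one_le_exp _
    _ = Real.exp (-(l * ((p + q) / 2)) + q * (Real.exp l - 1)) := by rw [Real.exp_add]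
    _ ≤ _ := by
        rw [Real.exp_le_exp, hpδ]
        have h1 : q * (Real.exp l - 1) ≤ q * (l + l ^ 2) := by gcongr; linarith
        have h2 : q * l ^ 2 ≤ p * l ^ 2 := by gcongr; linarith
        have h3 : p * l ^ 2 = l * δ / 2 := by linear_combination l * hlp
        have h4 : -(l * ((p + q) / 2)) + q * l = - (l * δ) := by rw [← hqp]; ring
        nlinarith

/-- Exponential moment of a negated Bernoulli(`p`) variable centred at `(p + q) / 2`, for the tilt
`δ / (2p)` with `δ = (p - q) / 2`. -/
theorem bern_exp_moment_lower_le {p q δ : ℝ} (hq : 0 ≤ q) (hδ : 0 < δ) (hqp : q + 2 * δ = p) :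
    p * Real.exp (δ / (2 * p) * ((p + q) / 2 - 1)) +
      (1 - p) * Real.exp (δ / (2 * p) * ((p + q) / 2 - 0)) ≤ Real.exp (-(δ ^ 2 / (4 * p))) := by
  have hp : 0 < p := by linarith
  set l := δ / (2 * p) with hl
  have hl0 : 0 < l := by positivity
  have hl1 : l ≤ 1 := by rw [hl, div_le_one (by positivity)]; linarith
  have hlp : l * p = δ / 2 := by rw [hl]; field_simp
  have h := (abs_le.mp (Real.abs_exp_sub_one_sub_id_le (x := -l)
    (by rwa [abs_neg, abs_of_pos hl0]))).2
  have hpδ : δ ^ 2 / (4 * p) = l * δ / 2 := by rw [hl]; field_simp; ring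
  calc _ = Real.exp (l * ((p + q) / 2)) * (p * (Real.exp (-l) - 1) + 1) := by
        rw [show l * ((p + q) / 2 - 1) = l * ((p + q) / 2) + -l by ring,
          show l * ((p + q) / 2 - 0) = l * ((p + q) / 2) by ring, Real.exp_add]
        ring
    _ ≤ Real.exp (l * ((p + q) / 2)) * Real.exp (p * (Real.exp (-l) - 1)) := by
        gcongr; exact Real.add_one_le_exp _
    _ = Real.exp (l * ((p + q) / 2) + p * (Real.exp (-l) - 1)) := by rw [Real.exp_add]
    _ ≤ _ := by
        rw [Real.exp_le_exp, hpδ]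
        have h1 : p * (Real.exp (-l) - 1) ≤ p * (-l + l ^ 2) := by gcongr; nlinarith
        have h3 : p * l ^ 2 = l * δ / 2 := by linear_combination l * hlp
        have h4 : l * ((p + q) / 2) - p * l = - (l * δ) := by rw [← hqp]; ring
        nlinarith

/-- The potential edges between `T` and `U`. -/
def cutEdges {n : ℕ} (T U : Finset (Fin n)) : Finset {e : Fin n × Fin n // e.1 < e.2} :=
  Finset.univ.filter fun e => (e.1.1 ∈ T ∧ e.1.2 ∈ U) ∨ (e.1.1 ∈ U ∧ e.1.2 ∈ T)

theorem cutEdges_comm {n : ℕ} (T U : Finset (Fin n)) : cutEdges T U = cutEdges U T := by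
  ext e; simp [cutEdges, or_comm]

theorem card_mul_card_le_card_cutEdges {n : ℕ} {T U : Finset (Fin n)} (h : Disjoint T U) :
    T.card * U.card ≤ (cutEdges T U).card := by
  rw [← Finset.card_product]
  have hne {a b : Fin n} (ha : a ∈ T) (hb : b ∈ U) : a ≠ b :=
    fun hab => Finset.disjoint_left.mp h ha (hab ▸ hb)
  refine Finset.card_le_card_of_surjOn
    (fun e => if e.1.1 ∈ T then e.1 else (e.1.2, e.1.1)) ?_
  rintro ⟨a, b⟩ hab
  simp only [Finset.coe_product, Set.mem_prod, Finset.mem_coe] at hab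
  obtain ⟨ha, hb⟩ := hab
  rcases lt_or_gt_of_ne (hne ha hb) with hlt | hlt
  · exact ⟨⟨(a, b), hlt⟩, by simp [cutEdges, ha, hb]⟩
  · refine ⟨⟨(b, a), hlt⟩, by simp [cutEdges, ha, hb], ?_⟩
    have : b ∉ T := fun hbT => hne hbT hb rfl
    simp [this]

/-- The number of edges of `G` between `T` and `U`, minus `m` times the number of pairs. -/
noncomputable def cutExcess {n : ℕ} (m : ℝ) (G : {e : Fin n × Fin n // e.1 < e.2} → Bool)
    (T U : Finset (Fin n)) : ℝ :=
  ∑ e ∈ cutEdges T U, ((if G e then 1 else 0) - m)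

theorem cutExcess_comm {n : ℕ} (m : ℝ) (G : {e : Fin n × Fin n // e.1 < e.2} → Bool)
    (T U : Finset (Fin n)) : cutExcess m G T U = cutExcess m G U T := by
  rw [cutExcess, cutExcess, cutEdges_comm]

theorem ofReal_exp_neg_pow_le {a b : ℝ} {N : ℕ} (h : b ≤ a * N) :
    ENNReal.ofReal (Real.exp (-a) ^ N) ≤ ENNReal.ofReal (Real.exp (-b)) := by
  refine ENNReal.ofReal_le_ofReal ?_
  rw [← Real.exp_nat_mul, Real.exp_le_exp]
  linarith

theorem isProbabilityMeasure_sbm {n k : ℕ} (c : Fin n → Fin k) {p q : ℝ} (hq : 0 < q)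
    (hqp : q < p) (hp : p ≤ 1) : IsProbabilityMeasure (sbm n k c p q) := by
  have (e : {e : Fin n × Fin n // e.1 < e.2}) :
      IsProbabilityMeasure (bern (if c e.1.1 = c e.1.2 then p else q)) := by
    split_ifs
    · exact isProbabilityMeasure_bern (by linarith) hp
    · exact isProbabilityMeasure_bern hq.le (by linarith)
  rw [sbm]
  infer_instance

theorem sbm_cutExcess_nonneg_le {n k : ℕ} (c : Fin n → Fin k) {p q : ℝ} (hq : 0 < q)
    (hqp : q < p) (hp : p ≤ 1) {T U : Finset (Fin n)} (hTU : ∀ u ∈ T, ∀ v ∈ U, c u ≠ c v) {b : ℝ}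
    (hb : b ≤ (p - q) ^ 2 / (16 * p) * (T.card * U.card)) :
    sbm n k c p q {G | 0 ≤ cutExcess ((p + q) / 2) G T U} ≤ ENNReal.ofReal (Real.exp (-b)) := by
  have hp0 : 0 < p := by linarith
  have hd : Disjoint T U := Finset.disjoint_left.mpr fun v hT hU => hTU v hT v hU rfl
  have hl : 0 < (p - q) / 2 / (2 * p) := div_pos (by linarith) (by linarith)
  have key := measure_pi_bern_sum_nonneg_le
    (r := fun e : {e : Fin n × Fin n // e.1 < e.2} => if c e.1.1 = c e.1.2 then p else q)
    (fun e => by split_ifs <;> linarith) (fun e => by split_ifs <;> linarith) (cutEdges T U)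
    (fun x => (p - q) / 2 / (2 * p) * ((if x then 1 else 0) - (p + q) / 2))
    (Real.exp_pos (-(((p - q) / 2) ^ 2 / (4 * p)))).le (by
      intro e he
      have hne : c e.1.1 ≠ c e.1.2 := by
        simp only [cutEdges, Finset.mem_filter, Finset.mem_univ, true_and] at he
        rcases he with ⟨h1, h2⟩ | ⟨h1, h2⟩
        · exact hTU _ h1 _ h2
        · exact (hTU _ h2 _ h1).symm
      simpa [hne] using bern_exp_moment_upper_le (p := p) hq.le (δ := (p - q) / 2) (by linarith) (by ring))
  refine (measure_mono fun G hG => ?_).trans (key.trans (ofReal_exp_neg_pow_le ?_))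
  · simp only [Set.mem_ofPred_eq, cutExcess] at hG ⊢
    rw [← Finset.mul_sum]
    exact mul_nonneg hl.le hG
  · refine hb.trans ?_
    rw [show ((p - q) / 2) ^ 2 / (4 * p) = (p - q) ^ 2 / (16 * p) by ring]
    gcongr
    exact_mod_cast card_mul_card_le_card_cutEdges hd

theorem sbm_cutExcess_nonpos_le {n k : ℕ} (c : Fin n → Fin k) {p q : ℝ} (hq : 0 < q)
    (hqp : q < p) (hp : p ≤ 1) {T U : Finset (Fin n)} (hd : Disjoint T U)
    (hTU : ∀ u ∈ T, ∀ v ∈ U, c u = c v) {b : ℝ}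
    (hb : b ≤ (p - q) ^ 2 / (16 * p) * (T.card * U.card)) :
    sbm n k c p q {G | cutExcess ((p + q) / 2) G T U ≤ 0} ≤ ENNReal.ofReal (Real.exp (-b)) := by
  have hp0 : 0 < p := by linarith
  have hl : 0 < (p - q) / 2 / (2 * p) := div_pos (by linarith) (by linarith)
  have key := measure_pi_bern_sum_nonneg_le
    (r := fun e : {e : Fin n × Fin n // e.1 < e.2} => if c e.1.1 = c e.1.2 then p else q)
    (fun e => by split_ifs <;> linarith) (fun e => by split_ifs <;> linarith) (cutEdges T U)
    (fun x => (p - q) / 2 / (2 * p) * ((p + q) / 2 - (if x then 1 else 0)))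
    (Real.exp_pos (-(((p - q) / 2) ^ 2 / (4 * p)))).le (by
      intro e he
      have hne : c e.1.1 = c e.1.2 := by
        simp only [cutEdges, Finset.mem_filter, Finset.mem_univ, true_and] at he
        rcases he with ⟨h1, h2⟩ | ⟨h1, h2⟩
        · exact hTU _ h1 _ h2
        · exact (hTU _ h2 _ h1).symm
      simpa [hne] using bern_exp_moment_lower_le (p := p) hq.le (δ := (p - q) / 2) (by linarith) (by ring))
  refine (measure_mono fun G hG => ?_).trans (key.trans (ofReal_exp_neg_pow_le ?_))
  · simp only [Set.mem_ofPred_eq, cutExcess] at hG ⊢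
    rw [← Finset.mul_sum]
    refine mul_nonneg hl.le ?_
    rw [← neg_nonneg, ← Finset.sum_neg_distrib] at hG
    simpa using hG
  · refine hb.trans ?_
    rw [show ((p - q) / 2) ^ 2 / (4 * p) = (p - q) ^ 2 / (16 * p) by ring]
    gcongr
    exact_mod_cast card_mul_card_le_card_cutEdges hd

/-- Union bound over nonempty vertex subsets with geometrically decaying failure probabilities. -/
theorem measure_iUnion_nonempty_le {Ω : Type*} [MeasurableSpace Ω] (μ : Measure Ω) {n : ℕ}
    (hn : 1 ≤ n) (B : Finset (Fin n) → Set Ω)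
    (h : ∀ D, D.Nonempty → μ (B D) ≤ ENNReal.ofReal (Real.exp (-(5 * Real.log n * D.card)))) :
    μ {ω | ∃ D : Finset (Fin n), D.Nonempty ∧ ω ∈ B D} ≤ ENNReal.ofReal (2 / (n : ℝ) ^ 4) := by
  have hn0 : (0 : ℝ) < n := by exact_mod_cast hn
  set x : ℝ := 1 / (n : ℝ) ^ 5 with hx
  have hx0 : 0 < x := by positivity
  have hexp (d : ℕ) : Real.exp (-(5 * Real.log n * d)) = x ^ d := by
    rw [show -(5 * Real.log n * d) = d * (-(((5 : ℕ) : ℝ) * Real.log n)) by push_cast; ring,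
      Real.exp_nat_mul, Real.exp_neg, Real.exp_nat_mul, Real.exp_log hn0, hx, one_div]
  have hsum : ∑ D ∈ (Finset.univ : Finset (Finset (Fin n))).erase ∅, x ^ D.card
      = (x + 1) ^ n - 1 := by
    have h1 := Finset.sum_pow_mul_eq_add_pow x 1 (Finset.univ : Finset (Fin n))
    simp only [one_pow, mul_one, Finset.powerset_univ, Finset.card_univ, Fintype.card_fin] at h1
    rw [← h1, ← Finset.add_sum_erase _ _ (Finset.mem_univ ∅)]
    simp
  have hnx : n * x = 1 / (n : ℝ) ^ 4 := by rw [hx]; field_simp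
  have hnx1 : n * x ≤ 1 := by
    rw [hnx, div_le_one (by positivity)]
    exact one_le_pow₀ (by exact_mod_cast hn)
  have hpow : (x + 1) ^ n - 1 ≤ 2 / (n : ℝ) ^ 4 := by
    have h1 : (x + 1) ^ n ≤ Real.exp (n * x) := by
      rw [Real.exp_nat_mul]
      gcongr
      exact Real.add_one_le_exp x
    have hnx0 : 0 ≤ n * x := by positivity
    have h2 := (abs_le.mp (Real.abs_exp_sub_one_sub_id_le (x := n * x)
      (by rwa [abs_of_nonneg hnx0]))).2
    have h3 : 2 / (n : ℝ) ^ 4 = 2 * (n * x) := by rw [hnx]; ring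
    nlinarith
  calc μ {ω | ∃ D : Finset (Fin n), D.Nonempty ∧ ω ∈ B D}
      ≤ μ (⋃ D ∈ (Finset.univ : Finset (Finset (Fin n))).erase ∅, B D) := by
        refine measure_mono fun ω hω => ?_
        obtain ⟨D, hD, hω⟩ := hω
        simp only [Set.mem_iUnion]
        exact ⟨D, by simpa using hD.ne_empty, hω⟩
    _ ≤ ∑ D ∈ (Finset.univ : Finset (Finset (Fin n))).erase ∅, μ (B D) :=
        measure_biUnion_finset_le _ _
    _ ≤ ∑ D ∈ (Finset.univ : Finset (Finset (Fin n))).erase ∅, ENNReal.ofReal (x ^ D.card) := by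
        refine Finset.sum_le_sum fun D hD => ?_
        rw [← hexp]
        exact h D (Finset.nonempty_iff_ne_empty.mpr (Finset.ne_of_mem_erase hD))
    _ = ENNReal.ofReal ((x + 1) ^ n - 1) := by
        rw [← ENNReal.ofReal_sum_of_nonneg fun _ _ => by positivity, hsum]
    _ ≤ _ := ENNReal.ofReal_le_ofReal hpow

/-- If no colour class takes up more than half of `S`, some union of colour classes takes up
between a quarter and three quarters of `S`. -/
theorem exists_balanced_colors {V K : Type*} [DecidableEq K] [Fintype K] (c : V → K)
    (S : Finset V) (h : ∀ i, 2 * (S.filter fun v => c v = i).card ≤ S.card) :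
    ∃ I : Finset K, S.card ≤ 4 * (S.filter fun v => c v ∈ I).card ∧
      4 * (S.filter fun v => c v ∈ I).card ≤ 3 * S.card := by
  classical
  obtain ⟨I, hI, hmin⟩ := Finset.exists_min_image
    (Finset.univ.filter fun I : Finset K => S.card ≤ 4 * (S.filter fun v => c v ∈ I).card)
    Finset.card ⟨Finset.univ, by simp; omega⟩
  simp only [Finset.mem_filter, Finset.mem_univ, true_and] at hI hmin
  refine ⟨I, hI, ?_⟩
  rcases I.eq_empty_or_nonempty with rfl | ⟨j, hj⟩
  · simp
  · have h1 : ¬ S.card ≤ 4 * (S.filter fun v => c v ∈ I.erase j).card := fun hle => by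
      have := hmin _ hle
      have := Finset.card_erase_lt_of_mem hj
      omega
    have h2 : (S.filter fun v => c v ∈ I).card ≤
        (S.filter fun v => c v ∈ I.erase j).card + (S.filter fun v => c v = j).card := by
      refine (Finset.card_le_card fun v hv => ?_).trans (Finset.card_union_le _ _)
      simp only [Finset.mem_union, Finset.mem_filter, Finset.mem_erase] at hv ⊢
      tauto
    have := h j
    omega

theorem card_clusterF_le_smax {n k : ℕ} (c : Fin n → Fin k) (i : Fin k) :
    (clusterF c i).card ≤ smax c :=
  Finset.le_sup (f := fun i => (clusterF c i).card) (Finset.mem_univ i)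

theorem exists_card_clusterF_eq_smax {n k : ℕ} (hk : 1 ≤ k) (c : Fin n → Fin k) :
    ∃ i, (clusterF c i).card = smax c := by
  have : Nonempty (Fin k) := ⟨⟨0, hk⟩⟩
  obtain ⟨i, -, hi⟩ := Finset.exists_mem_eq_sup Finset.univ Finset.univ_nonempty
    fun i => (clusterF c i).card
  exact ⟨i, hi.symm⟩

theorem smax_le {n k : ℕ} (c : Fin n → Fin k) : smax c ≤ n :=
  Finset.sup_le fun _ _ => (Finset.card_le_univ _).trans_eq (Fintype.card_fin n)

/-- Every cut of `S` has edge density more than `m`. -/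
def IsHomogeneous {n : ℕ} (m : ℝ) (G : {e : Fin n × Fin n // e.1 < e.2} → Bool)
    (S : Finset (Fin n)) : Prop :=
  ∀ T ⊆ S, T.Nonempty → T ≠ S → 0 < cutExcess m G T (S \ T)

theorem exists_largest_isHomogeneous {n : ℕ} (m : ℝ)
    (G : {e : Fin n × Fin n // e.1 < e.2} → Bool) :
    ∃ S, IsHomogeneous m G S ∧ ∀ S', IsHomogeneous m G S' → S'.card ≤ S.card := by
  classical
  obtain ⟨S, hS, hmax⟩ := Finset.exists_max_image
    (Finset.univ.filter fun S => IsHomogeneous m G S) Finset.card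
    ⟨∅, Finset.mem_filter.mpr ⟨Finset.mem_univ _, fun T hT hne _ =>
      absurd (Finset.subset_empty.mp hT) hne.ne_empty⟩⟩
  simp only [Finset.mem_filter, Finset.mem_univ, true_and] at hS hmax
  exact ⟨S, hS, hmax⟩

theorem isHomogeneous_of_small_cuts {n : ℕ} {m : ℝ}
    {G : {e : Fin n × Fin n // e.1 < e.2} → Bool} {S : Finset (Fin n)}
    (h : ∀ T ⊆ S, T.Nonempty → 2 * T.card ≤ S.card → 0 < cutExcess m G T (S \ T)) :
    IsHomogeneous m G S := by
  intro T hT hne hTS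
  by_cases hc : 2 * T.card ≤ S.card
  · exact h T hT hne hc
  · have hcard := Finset.card_sdiff_add_card_eq_card hT
    have := h (S \ T) Finset.sdiff_subset
      (Finset.sdiff_nonempty.mpr fun hST => hTS (hT.antisymm hST)) (by omega)
    rwa [Finset.sdiff_sdiff_eq_self hT, cutExcess_comm] at this

section Bounds

variable {n k : ℕ} (c : Fin n → Fin k) {p q : ℝ}

theorem five_log_mul_le (hqp : q < p) (hq : 0 < q)
    (hs : 80 * Real.log n ≤ (p - q) ^ 2 / (16 * p) * smax c) {d t u : ℕ}
    (h : d * smax c ≤ 16 * (t * u)) :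
    5 * Real.log n * d ≤ (p - q) ^ 2 / (16 * p) * (t * u) := by
  have hp : 0 < p := by linarith
  have h' : (d : ℝ) * smax c ≤ 16 * (t * u) := by exact_mod_cast h
  have hr : 0 ≤ (p - q) ^ 2 / (16 * p) := by positivity
  have h1 := mul_le_mul_of_nonneg_left h' hr
  have h2 := mul_le_mul_of_nonneg_right hs (Nat.cast_nonneg (α := ℝ) d)
  linarith

/-- A fixed small cut of a largest cluster is unlikely to be sparse. -/
theorem sbm_sparse_cut_le (hq : 0 < q) (hqp : q < p) (hp : p ≤ 1)
    (hs : 80 * Real.log n ≤ (p - q) ^ 2 / (16 * p) * smax c) {i : Fin k}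
    (hi : (clusterF c i).card = smax c) (D : Finset (Fin n)) :
    sbm n k c p q {G | D ⊆ clusterF c i ∧ 2 * D.card ≤ (clusterF c i).card ∧
        cutExcess ((p + q) / 2) G D (clusterF c i \ D) ≤ 0} ≤
      ENNReal.ofReal (Real.exp (-(5 * Real.log n * D.card))) := by
  by_cases h : D ⊆ clusterF c i ∧ 2 * D.card ≤ (clusterF c i).card
  · obtain ⟨h1, h2⟩ := h
    refine (measure_mono fun G hG => hG.2.2).trans
      (sbm_cutExcess_nonpos_le c hq hqp hp Finset.disjoint_sdiff (fun u hu v hv => ?_)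
        (five_log_mul_le c hqp hq hs ?_))
    · have hu := h1 hu
      have hv := Finset.sdiff_subset hv
      simp only [clusterF, Finset.mem_filter, Finset.mem_univ, true_and] at hu hv
      rw [hu, hv]
    · have hcard := Finset.card_sdiff_add_card_eq_card h1
      rw [← hi]
      nlinarith
  · rw [show {G | D ⊆ clusterF c i ∧ 2 * D.card ≤ (clusterF c i).card ∧
        cutExcess ((p + q) / 2) G D (clusterF c i \ D) ≤ 0} = ∅ from
      Set.eq_empty_of_forall_notMem fun G hG => h ⟨hG.1, hG.2.1⟩]
    simp

/-- A fixed large set without a majority cluster is unlikely to be homogeneous. -/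
theorem sbm_isHomogeneous_balanced_le (hq : 0 < q) (hqp : q < p) (hp : p ≤ 1)
    (hs : 80 * Real.log n ≤ (p - q) ^ 2 / (16 * p) * smax c) {D : Finset (Fin n)}
    (hD : D.Nonempty) :
    sbm n k c p q {G | IsHomogeneous ((p + q) / 2) G D ∧ smax c ≤ D.card ∧
        ∀ i, 2 * (D.filter fun v => c v = i).card ≤ D.card} ≤
      ENNReal.ofReal (Real.exp (-(5 * Real.log n * D.card))) := by
  by_cases h : smax c ≤ D.card ∧ ∀ i, 2 * (D.filter fun v => c v = i).card ≤ D.card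
  · obtain ⟨h1, h2⟩ := h
    obtain ⟨I, hI1, hI2⟩ := exists_balanced_colors c D h2
    set T := D.filter fun v => c v ∈ I with hT
    have hTD : T ⊆ D := Finset.filter_subset _ _
    have hcard := Finset.card_sdiff_add_card_eq_card hTD
    have hpos := hD.card_pos
    have hTne : T ≠ D := fun hEq => by
      rw [hEq] at hI2
      omega
    refine (measure_mono fun G hG => (hG.1 T hTD (Finset.card_pos.mp (by omega)) hTne).le).trans
      (sbm_cutExcess_nonneg_le c hq hqp hp (T := T) (U := D \ T) (fun u hu v hv huv => ?_)
        (five_log_mul_le c hqp hq hs ?_))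
    · simp only [hT, Finset.mem_filter, Finset.mem_sdiff, not_and] at hu hv
      exact hv.2 hv.1 (huv ▸ hu.2)
    · calc D.card * smax c ≤ D.card * D.card := Nat.mul_le_mul_left _ h1
        _ ≤ (4 * T.card) * (4 * (D \ T).card) := Nat.mul_le_mul hI1 (by omega)
        _ = _ := by ring
  · rw [show {G | IsHomogeneous ((p + q) / 2) G D ∧ smax c ≤ D.card ∧
        ∀ i, 2 * (D.filter fun v => c v = i).card ≤ D.card} = ∅ from
      Set.eq_empty_of_forall_notMem fun G hG => h hG.2]
    simp

/-- A fixed large set with a majority cluster, but different from it, is unlikely to be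
homogeneous. The set is parametrized by its symmetric difference `D` with the cluster. -/
theorem sbm_isHomogeneous_majority_le (hq : 0 < q) (hqp : q < p) (hp : p ≤ 1)
    (hs : 80 * Real.log n ≤ (p - q) ^ 2 / (16 * p) * smax c) (i : Fin k) {D : Finset (Fin n)}
    (hD : D.Nonempty) :
    sbm n k c p q {G | IsHomogeneous ((p + q) / 2) G (symmDiff D (clusterF c i)) ∧
        smax c ≤ (symmDiff D (clusterF c i)).card ∧ (symmDiff D (clusterF c i)).card <
          2 * (symmDiff D (clusterF c i) ∩ clusterF c i).card} ≤
      ENNReal.ofReal (Real.exp (-(5 * Real.log n * D.card))) := by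
  set V := clusterF c i with hV
  set S := symmDiff D V with hS
  by_cases h : smax c ≤ S.card ∧ S.card < 2 * (S ∩ V).card
  · obtain ⟨h1, h2⟩ := h
    have hVs : V.card ≤ smax c := card_clusterF_le_smax c i
    have hDS : D = symmDiff S V := by rw [hS, symmDiff_symmDiff_cancel_right]
    have hSV : S ≠ V := fun hEq => by
      rw [hEq, symmDiff_self] at hDS
      exact hD.ne_empty hDS
    have hDcard : D.card ≤ (S \ V).card + (V \ S).card := by
      rw [hDS]
      exact Finset.card_union_le _ _
    have hc1 := Finset.card_sdiff_add_card_inter S V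
    have hc2 := Finset.card_sdiff_add_card_inter V S
    rw [Finset.inter_comm] at hc2
    have hne : (S \ V).Nonempty := Finset.sdiff_nonempty.mpr fun hsub =>
      hSV (Finset.eq_of_subset_of_card_le hsub (hVs.trans h1))
    have hcompl : S \ (S \ V) = S ∩ V := Finset.sdiff_sdiff_self_left S V
    have hSVne : S \ V ≠ S := fun hEq => by
      rw [hEq] at hc1
      omega
    refine (measure_mono fun G hG => (hG.1 (S \ V) Finset.sdiff_subset hne hSVne).le).trans
      (sbm_cutExcess_nonneg_le c hq hqp hp (T := S \ V) (U := S \ (S \ V))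
        (fun u hu v hv huv => ?_) (five_log_mul_le c hqp hq hs ?_))
    · rw [hcompl] at hv
      simp only [hV, clusterF, Finset.mem_filter, Finset.mem_univ, Finset.mem_sdiff,
        Finset.mem_inter, true_and] at hu hv
      exact hu.2 (huv.trans hv.2)
    · rw [hcompl]
      calc D.card * smax c ≤ (2 * (S \ V).card) * (2 * (S ∩ V).card) :=
            Nat.mul_le_mul (by omega) (by omega)
        _ ≤ _ := by nlinarith
  · rw [show {G | IsHomogeneous ((p + q) / 2) G S ∧ smax c ≤ S.card ∧
        S.card < 2 * (S ∩ V).card} = ∅ from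
      Set.eq_empty_of_forall_notMem fun G hG => h hG.2]
    simp

theorem log_le_of_sbar_le (hn : 4 ≤ n) (hq : 0 < q) (hqp : q < p) (hp : p ≤ 3 / 4)
    (hs : sbar n p q ≤ (smax c : ℝ)) :
    0 < smax c ∧ 80 * Real.log n ≤ (p - q) ^ 2 / (16 * p) * smax c := by
  have hn4 : (4 : ℝ) ≤ n := by exact_mod_cast hn
  have hp0 : 0 < p := by linarith
  have hpq : 0 < p - q := by linarith
  have hL : 1 ≤ Real.log n := by
    rw [Real.le_log_iff_exp_le (by linarith)]
    linarith [Real.exp_one_lt_d9]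
  have hw : 0 < p * (1 - q) * n := by
    have : 0 < 1 - q := by linarith
    positivity
  have hs0 : (0 : ℝ) < smax c := lt_of_lt_of_le
    (by rw [sbar]; have := Real.sqrt_pos.mpr hw; positivity) hs
  refine ⟨by exact_mod_cast hs0, ?_⟩
  set s : ℝ := (smax c : ℝ)
  have hsn : s ≤ n := Nat.cast_le.mpr (smax_le c)
  rw [sbar, div_le_iff₀ hpq] at hs
  have hsq := pow_le_pow_left₀ (by positivity) hs 2
  rw [mul_pow, mul_pow, Real.sq_sqrt hw.le, mul_pow] at hsq
  have h1 : 2 ^ 24 * (p * s * Real.log n) ≤ (2 ^ 13) ^ 2 * (p * (1 - q) * n) * Real.log n ^ 2 := by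
    have h2 : p * s * Real.log n ≤ p * n * Real.log n ^ 2 := by
      have : Real.log n ≤ Real.log n ^ 2 := by nlinarith
      gcongr
    have h3 : p * n * Real.log n ^ 2 * (1 / 4) ≤ p * n * Real.log n ^ 2 * (1 - q) := by
      gcongr
      linarith
    linarith
  have h4 : 2 ^ 24 * (p * Real.log n) ≤ s * (p - q) ^ 2 := by
    refine le_of_mul_le_mul_right ?_ hs0
    linarith
  rw [div_mul_eq_mul_div, le_div_iff₀ (by positivity)]
  have : 0 ≤ p * Real.log n := by positivity
  linarith

/-- Except with probability `1 / n²`, every largest homogeneous set is a cluster of maximal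
size. -/
theorem sbm_largest_isHomogeneous (hn : 4 ≤ n) (hk : 1 ≤ k) (hq : 0 < q) (hqp : q < p)
    (hp : p ≤ 3 / 4) (hs : sbar n p q ≤ (smax c : ℝ))
    {f : ({e : Fin n × Fin n // e.1 < e.2} → Bool) → Finset (Fin n)}
    (hf : ∀ G, IsHomogeneous ((p + q) / 2) G (f G) ∧
      ∀ S, IsHomogeneous ((p + q) / 2) G S → S.card ≤ (f G).card) :
    ENNReal.ofReal (1 - 1 / (n : ℝ) ^ 2) ≤
      sbm n k c p q {G | ∃ i, f G = clusterF c i ∧ smax c ≤ (clusterF c i).card} := by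
  have hp1 : p ≤ 1 := by linarith
  have := isProbabilityMeasure_sbm c hq hqp hp1
  obtain ⟨hs0, hs⟩ := log_le_of_sbar_le c hn hq hqp hp hs
  obtain ⟨i₀, hi₀⟩ := exists_card_clusterF_eq_smax hk c
  set μ := sbm n k c p q
  set m := (p + q) / 2
  have hn1 : 1 ≤ n := by omega
  have hL := measure_iUnion_nonempty_le μ hn1 _ fun D _ => sbm_sparse_cut_le c hq hqp hp1 hs hi₀ D
  have hA := measure_iUnion_nonempty_le μ hn1 _ fun D hD =>
    sbm_isHomogeneous_balanced_le c hq hqp hp1 hs hD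
  have hB (v : Fin n) := measure_iUnion_nonempty_le μ hn1 _ fun D hD =>
    sbm_isHomogeneous_majority_le c hq hqp hp1 hs (c v) hD
  set L := {G | ∃ D : Finset (Fin n), D.Nonempty ∧ G ∈ {G | D ⊆ clusterF c i₀ ∧
    2 * D.card ≤ (clusterF c i₀).card ∧ cutExcess m G D (clusterF c i₀ \ D) ≤ 0}}
  set A := {G | ∃ D : Finset (Fin n), D.Nonempty ∧ G ∈ {G | IsHomogeneous m G D ∧
    smax c ≤ D.card ∧ ∀ i, 2 * (D.filter fun v => c v = i).card ≤ D.card}}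
  set B := fun v : Fin n => {G | ∃ D : Finset (Fin n), D.Nonempty ∧ G ∈
    {G | IsHomogeneous m G (symmDiff D (clusterF c (c v))) ∧
      smax c ≤ (symmDiff D (clusterF c (c v))).card ∧ (symmDiff D (clusterF c (c v))).card <
        2 * (symmDiff D (clusterF c (c v)) ∩ clusterF c (c v)).card}}
  set W := {G | ∃ i, f G = clusterF c i ∧ smax c ≤ (clusterF c i).card}
  have hcover : (Set.univ : Set ({e : Fin n × Fin n // e.1 < e.2} → Bool)) ⊆
      W ∪ (L ∪ (A ∪ ⋃ v, B v)) := by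
    intro G _
    by_cases hGL : G ∈ L
    · exact Or.inr (Or.inl hGL)
    have hV : IsHomogeneous m G (clusterF c i₀) := isHomogeneous_of_small_cuts
      fun T hT hne hcard => by
        by_contra hle
        exact hGL ⟨T, hne, hT, hcard, not_lt.mp hle⟩
    have hlarge : smax c ≤ (f G).card := hi₀ ▸ (hf G).2 _ hV
    by_cases hbal : ∀ i, 2 * ((f G).filter fun v => c v = i).card ≤ (f G).card
    · exact Or.inr (Or.inr (Or.inl
        ⟨f G, Finset.card_pos.mp (by omega), (hf G).1, hlarge, hbal⟩))
    · push Not at hbal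
      obtain ⟨i, hi⟩ := hbal
      by_cases heq : f G = clusterF c i
      · exact Or.inl ⟨i, heq, heq ▸ hlarge⟩
      · obtain ⟨v, hv⟩ := Finset.card_pos.mp (by omega :
          0 < ((f G).filter fun v => c v = i).card)
        obtain rfl : c v = i := (Finset.mem_filter.mp hv).2
        refine Or.inr (Or.inr (Or.inr (Set.mem_iUnion.mpr
          ⟨v, symmDiff (f G) (clusterF c (c v)), ?_, ?_⟩)))
        · rw [Finset.nonempty_iff_ne_empty]
          exact fun h => heq (symmDiff_eq_bot.mp h)
        · have hinter : f G ∩ clusterF c (c v) = (f G).filter fun w => c w = c v := by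
            ext w; simp [clusterF]
          simp only [Set.mem_ofPred_eq, symmDiff_symmDiff_cancel_right, hinter]
          exact ⟨(hf G).1, hlarge, hi⟩
  have hn0 : (4 : ℝ) ≤ n := by exact_mod_cast hn
  set b : ℝ := 2 / (n : ℝ) ^ 4 with hb
  have hb0 : 0 ≤ b := by positivity
  have hBsum : μ (⋃ v, B v) ≤ ENNReal.ofReal (n * b) := by
    refine (measure_iUnion_fintype_le _ _).trans ((Finset.sum_le_sum fun v _ => hB v).trans_eq ?_)
    rw [Finset.sum_const, Finset.card_univ, Fintype.card_fin, nsmul_eq_mul,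
      ENNReal.ofReal_mul (by positivity), ENNReal.ofReal_natCast]
  have hbad : μ (L ∪ (A ∪ ⋃ v, B v)) ≤ ENNReal.ofReal (1 / (n : ℝ) ^ 2) := by
    refine (measure_union_le _ _).trans ((add_le_add hL ((measure_union_le _ _).trans
      (add_le_add hA hBsum))).trans ?_)
    rw [← ENNReal.ofReal_add hb0 (by positivity), ← ENNReal.ofReal_add hb0 (by positivity)]
    refine ENNReal.ofReal_le_ofReal ?_
    rw [hb, show 2 / (n : ℝ) ^ 4 + (2 / (n : ℝ) ^ 4 + n * (2 / (n : ℝ) ^ 4)) =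
      (4 + 2 * n) / (n : ℝ) ^ 4 by ring, div_le_div_iff₀ (by positivity) (by positivity)]
    have : 4 + 2 * (n : ℝ) ≤ n ^ 2 := by nlinarith
    calc (4 + 2 * (n : ℝ)) * n ^ 2 ≤ n ^ 2 * n ^ 2 := by gcongr
      _ = _ := by ring
  rw [ENNReal.ofReal_sub _ (by positivity), ENNReal.ofReal_one, tsub_le_iff_right]
  calc (1 : ENNReal) = μ Set.univ := measure_univ.symm
    _ ≤ μ W + μ (L ∪ (A ∪ ⋃ v, B v)) := (measure_mono hcover).trans (measure_union_le _ _)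
    _ ≤ _ := by gcongr

end Bounds

/-- There exist absolute constants `C₀ > 0` and `n₀` such that for all `n ≥ n₀`,
`k ≥ 1` and `0 < q < p ≤ 3/4` with `σ² ≥ C₀ log n / n`, there is an estimator `f` from graphs on
`n` vertices to vertex subsets such that for every hidden partition whose largest cluster size
`s_max` satisfies `s_max ≥ s̄`, with probability at least `1 − 1/n²` over `G ~ SBM(n,k,p,q)`,
the output `f G` equals some cluster `V_i`, and this cluster has size at least `s_max/7`. -/
theorem statement_0 :
    ∃ (C₀ : ℝ) (n₀ : ℕ), 0 < C₀ ∧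
      ∀ (n k : ℕ), n₀ ≤ n → 1 ≤ k →
        ∀ p q : ℝ, 0 < q → q < p → p ≤ 3 / 4 →
          C₀ * Real.log n / n ≤ (sigSBM p q) ^ 2 →
          ∃ f : ({e : Fin n × Fin n // e.1 < e.2} → Bool) → Finset (Fin n),
            ∀ c : Fin n → Fin k,
              sbar n p q ≤ (smax c : ℝ) →
              ENNReal.ofReal (1 - 1 / (n : ℝ) ^ 2) ≤
                sbm n k c p q
                  {G | ∃ i : Fin k, f G = clusterF c i ∧
                    (smax c : ℝ) ≤ 7 * ((clusterF c i).card : ℝ)} := by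
  refine ⟨1, 4, one_pos, fun n k hn hk p q hq hqp hp _ => ?_⟩
  choose f hf using fun G => exists_largest_isHomogeneous (n := n) ((p + q) / 2) G
  refine ⟨f, fun c hs => (sbm_largest_isHomogeneous c hn hk hq hqp hp hs hf).trans
    (measure_mono fun G hG => ?_)⟩
  obtain ⟨i, hi, hle⟩ := hG
  have : (smax c : ℝ) ≤ (clusterF c i).card := by exact_mod_cast hle
  exact ⟨i, hi, by linarith [Nat.cast_nonneg (α := ℝ) (clusterF c i).card]⟩
end

section
/- For x, y ∈ (0,1), let D(x‖y) := x·ln(x/y) + (1−x)·ln((1−x)/(1−y)) denote the Kullback–Leibler divergence between Bernoulli(x) and Bernoulli(y). If x ≥ y then D(x‖y) ≥ (x−y)²/(2x), and if x ≤ y then D(x‖y) ≥ (x−y)²/(2y). -/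
/-- Second-order Taylor lower bound for `-log (1 - s)`. -/
lemma add_sq_div_two_le_neg_log_one_sub {s : ℝ} (hs0 : 0 ≤ s) (hs1 : s < 1) :
    s + s ^ 2 / 2 ≤ -Real.log (1 - s) := by
  have h := Real.hasSum_pow_div_log_of_abs_lt_one (abs_lt.2 ⟨by linarith, hs1⟩)
  have h2 := sum_le_hasSum (Finset.range 2) (fun i _ => by positivity) h
  norm_num [Finset.sum_range_succ] at h2
  linarith

lemma log_le_sub_inv_div_two {v : ℝ} (hv : 1 ≤ v) : Real.log v ≤ (v - v⁻¹) / 2 := by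
  rw [← Real.sinh_log (by linarith)]
  exact Real.self_le_sinh_iff.2 (Real.log_nonneg hv)

lemma sub_le_mul_log_div {a b : ℝ} (ha : 0 < a) (hb : 0 < b) :
    a - b ≤ a * Real.log (a / b) := by
  have h := mul_le_mul_of_nonneg_left (Real.one_sub_inv_le_log_of_pos (div_pos ha hb)) ha.le
  have e : a * (1 - (a / b)⁻¹) = a - b := by field_simp
  linarith

/-- For `x, y ∈ (0,1)`, let
`D(x‖y) := x·ln(x/y) + (1−x)·ln((1−x)/(1−y))` be the KL divergence between `Bernoulli(x)` and
`Bernoulli(y)`. If `x ≥ y` then `D(x‖y) ≥ (x−y)²/(2x)`, and if `x ≤ y` then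
`D(x‖y) ≥ (x−y)²/(2y)`. -/
theorem statement_4 (x y : ℝ) (hx0 : 0 < x) (hx1 : x < 1) (hy0 : 0 < y) (hy1 : y < 1) :
    (y ≤ x →
      (x - y) ^ 2 / (2 * x) ≤ x * Real.log (x / y) + (1 - x) * Real.log ((1 - x) / (1 - y))) ∧
    (x ≤ y →
      (x - y) ^ 2 / (2 * y) ≤ x * Real.log (x / y) + (1 - x) * Real.log ((1 - x) / (1 - y))) := by
  have hc := sub_le_mul_log_div (sub_pos.2 hx1) (sub_pos.2 hy1)
  constructor <;> intro h
  · have hs : (x - y) / x < 1 := by rw [div_lt_one hx0]; linarith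
    have h1 := add_sq_div_two_le_neg_log_one_sub (div_nonneg (sub_nonneg.2 h) hx0.le) hs
    have e : 1 - (x - y) / x = (x / y)⁻¹ := by field_simp; ring
    rw [e, Real.log_inv, neg_neg] at h1
    have h2 := mul_le_mul_of_nonneg_left h1 hx0.le
    have e2 : x * ((x - y) / x + ((x - y) / x) ^ 2 / 2) = (x - y) + (x - y) ^ 2 / (2 * x) := by
      field_simp
    linarith
  · have h1 := log_le_sub_inv_div_two ((one_le_div hx0).2 h)
    have h2 := mul_le_mul_of_nonneg_left h1 hx0.le
    have e : Real.log (x / y) = -Real.log (y / x) := by rw [← Real.log_inv, inv_div]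
    have e2 : x * ((y / x - (y / x)⁻¹) / 2) = (y - x) - (x - y) ^ 2 / (2 * y) := by
      field_simp; ring
    rw [e]
    linarith
end

section
/- Let V be an n-vertex set with a partition V = V₁ ∪ ⋯ ∪ V_k, let 0 < q < p ≤ 3/4 with p·n ≥ 1, and set s̄ := 2^13·√(p(1−q)·n)·log n/(p−q). Let W ⊆ V be a fixed subset and let the edges among W be present independently: with probability p if both endpoints lie in the same cluster and with probability q otherwise. Suppose s′ ≥ 0.48·s̄ and T₁ = V_i ∩ W for some cluster V_i, with |T₁| ≥ s′/6. Then with probability at least 1 − n^{−8}: every u ∈ T₁ satisfies N_{T₁}(u) ≥ (0.9p + 0.1q)·|T₁|, and every u ∈ W ∖ T₁ satisfies N_{T₁}(u) ≤ (0.9p + 0.1q)·|T₁|. -/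
open MeasureTheory

def adjB {n : ℕ} (G : {e : Fin n × Fin n // e.1 < e.2} → Bool) (u v : Fin n) : Bool :=
  if h : u < v then G ⟨(u, v), h⟩ else if h' : v < u then G ⟨(v, u), h'⟩ else false

/-- `N_S(v)`: the number of neighbors of `v` in `S` (not counting `v` itself). -/
def nbr {n : ℕ} (G : {e : Fin n × Fin n // e.1 < e.2} → Bool) (S : Finset (Fin n)) (v : Fin n) :
    ℕ :=
  (S.filter fun u => adjB G u v = true).card

open ProbabilityTheory

lemma isProbabilityMeasure_bern_s12 {p : ℝ} (hp0 : 0 ≤ p) (hp1 : p ≤ 1) :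
    IsProbabilityMeasure (bern p) := ⟨by
  simp only [bern, Measure.coe_add, Measure.coe_smul, Pi.add_apply, Pi.smul_apply, measure_univ,
    smul_eq_mul, mul_one]
  rw [← ENNReal.ofReal_add hp0 (by linarith)]
  simp⟩

lemma integral_bern {p : ℝ} (hp0 : 0 ≤ p) (hp1 : p ≤ 1) (f : Bool → ℝ) :
    ∫ b, f b ∂(bern p) = p * f true + (1 - p) * f false := by
  rw [bern, integral_add_measure, integral_smul_measure, integral_smul_measure]
  · simp [hp0, hp1]
  · exact (integrable_dirac (by simp)).smul_measure ENNReal.ofReal_ne_top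
  · exact (integrable_dirac (by simp)).smul_measure ENNReal.ofReal_ne_top

/-- Sub-Poissonian bound for the moment generating function of a sum of independent Bernoulli
variables with common success probability. -/
lemma mgf_card_filter_le {ι : Type*} [Fintype ι] [DecidableEq ι] (r : ι → Set.Icc (0 : ℝ) 1)
    (S : Finset ι) (ρ : ℝ) (hS : ∀ e ∈ S, (r e : ℝ) = ρ) (hρ : 0 ≤ ρ) {t : ℝ} (ht : |t| ≤ 1) :
    mgf (fun G : ι → Bool => ((S.filter fun e => G e = true).card : ℝ))
      (Measure.pi fun e => bern (r e)) t ≤ Real.exp (S.card * (ρ * (t + t ^ 2))) := by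
  have hprod (G : ι → Bool) : Real.exp (t * ((S.filter fun e => G e = true).card : ℝ)) =
      ∏ e, (if e ∈ S ∧ G e = true then Real.exp t else 1) := by
    rw [mul_comm, Real.exp_nat_mul, ← Finset.prod_filter, Finset.prod_const]
    congr 2
    ext e
    simp
  have (e : ι) : IsProbabilityMeasure (bern (r e)) :=
    isProbabilityMeasure_bern_s12 (r e).2.1 (r e).2.2
  simp only [mgf, hprod]
  rw [integral_fintype_prod_eq_prod
    (f := fun e (b : Bool) => if e ∈ S ∧ b = true then Real.exp t else 1)]
  calc _ ≤ ∏ e : ι, (if e ∈ S then Real.exp (ρ * (t + t ^ 2)) else 1) := by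
        refine Finset.prod_le_prod (fun e _ => integral_nonneg fun b => ?_) fun e _ => ?_
        · dsimp only [Pi.zero_apply]
          split_ifs <;> positivity
        · rw [integral_bern (r e).2.1 (r e).2.2]
          by_cases he : e ∈ S
          · simp only [he, hS e he, true_and, if_true, Bool.false_eq_true, if_false]
            have h1 := (abs_le.1 (Real.abs_exp_sub_one_sub_id_le ht)).2
            have h2 := Real.add_one_le_exp (ρ * (t + t ^ 2))
            nlinarith [mul_le_mul_of_nonneg_left h1 hρ]
          · simp [he]
    _ = _ := by
        rw [Finset.prod_ite_mem, Finset.univ_inter, Finset.prod_const, ← Real.exp_nat_mul]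

lemma measureReal_le_card_filter_le {ι : Type*} [Fintype ι] [DecidableEq ι]
    (r : ι → Set.Icc (0 : ℝ) 1) (S : Finset ι) (ρ : ℝ) (hS : ∀ e ∈ S, (r e : ℝ) = ρ) (hρ : 0 ≤ ρ)
    (a : ℝ) {t : ℝ} (ht0 : 0 ≤ t) (ht1 : t ≤ 1) :
    (Measure.pi fun e => bern (r e)).real
      {G | a ≤ ((S.filter fun e => G e = true).card : ℝ)} ≤
      Real.exp (-t * a + S.card * (ρ * (t + t ^ 2))) := by
  have (e : ι) : IsProbabilityMeasure (bern (r e)) :=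
    isProbabilityMeasure_bern_s12 (r e).2.1 (r e).2.2
  rw [Real.exp_add]
  refine (measure_ge_le_exp_mul_mgf a ht0 .of_finite).trans ?_
  gcongr
  exact mgf_card_filter_le r S ρ hS hρ (abs_le.2 ⟨by linarith, ht1⟩)

lemma measureReal_card_filter_le_le {ι : Type*} [Fintype ι] [DecidableEq ι]
    (r : ι → Set.Icc (0 : ℝ) 1) (S : Finset ι) (ρ : ℝ) (hS : ∀ e ∈ S, (r e : ℝ) = ρ) (hρ : 0 ≤ ρ)
    (a : ℝ) {t : ℝ} (ht0 : 0 ≤ t) (ht1 : t ≤ 1) :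
    (Measure.pi fun e => bern (r e)).real
      {G | ((S.filter fun e => G e = true).card : ℝ) ≤ a} ≤
      Real.exp (t * a + S.card * (ρ * (-t + t ^ 2))) := by
  have (e : ι) : IsProbabilityMeasure (bern (r e)) :=
    isProbabilityMeasure_bern_s12 (r e).2.1 (r e).2.2
  rw [Real.exp_add]
  refine (measure_le_le_exp_mul_mgf a (neg_nonpos.2 ht0) .of_finite).trans ?_
  rw [neg_neg]
  gcongr
  have := mgf_card_filter_le r S ρ hS hρ (t := -t) (abs_le.2 ⟨by linarith, by linarith⟩)
  rwa [neg_sq] at this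

/-- The potential edges joining `u` to the vertices of `T`. -/
def edgesTo {n : ℕ} (T : Finset (Fin n)) (u : Fin n) :
    Finset {e : Fin n × Fin n // e.1 < e.2} :=
  Finset.univ.filter fun e => (e.1.1 = u ∧ e.1.2 ∈ T) ∨ (e.1.2 = u ∧ e.1.1 ∈ T)

lemma nbr_eq_card_filter_edgesTo {n : ℕ} (G : {e : Fin n × Fin n // e.1 < e.2} → Bool)
    (T : Finset (Fin n)) (u : Fin n) :
    nbr G T u = ((edgesTo T u).filter fun e => G e = true).card := by
  symm
  refine Finset.card_bij (fun e _ => if e.1.1 = u then e.1.2 else e.1.1) ?_ ?_ ?_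
  · rintro ⟨⟨a, b⟩, hab⟩ h
    simp only [edgesTo, Finset.mem_filter, Finset.mem_univ, true_and] at h hab
    obtain ⟨⟨rfl, hb⟩ | ⟨rfl, ha⟩, hG⟩ := h
    · refine Finset.mem_filter.2 ⟨by simpa using hb, ?_⟩
      simp [adjB, hab, hab.not_gt, hG]
    · refine Finset.mem_filter.2 ⟨by simpa [hab.ne] using ha, ?_⟩
      simp [adjB, hab, hab.ne, hG]
  · rintro ⟨⟨a, b⟩, hab⟩ h ⟨⟨a', b'⟩, hab'⟩ h' he
    simp only [edgesTo, Finset.mem_filter, Finset.mem_univ, true_and] at h h' hab hab' he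
    simp only [Subtype.mk.injEq, Prod.mk.injEq]
    grind
  · intro v hv
    obtain ⟨hvT, hv⟩ := Finset.mem_filter.1 hv
    rw [adjB] at hv
    split_ifs at hv with h1 h2
    · exact ⟨⟨(v, u), h1⟩, by simp [edgesTo, hvT, hv], by simp [h1.ne]⟩
    · exact ⟨⟨(u, v), h2⟩, by simp [edgesTo, hvT, hv], by simp⟩

lemma card_edgesTo {n : ℕ} (T : Finset (Fin n)) (u : Fin n) :
    (edgesTo T u).card = (T.erase u).card := by
  have h := nbr_eq_card_filter_edgesTo (fun _ => true) T u
  simp only [Finset.filter_true] at h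
  rw [← h, nbr]
  congr 1
  ext v
  simp only [Finset.mem_filter, adjB, Finset.mem_erase]
  grind

/-- The signal-to-noise estimate behind the concentration bounds. -/
lemma mul_log_sq_le_of_sbar_le {n T : ℕ} {p q : ℝ} (hq : 0 < q) (hpq : q < p) (hp : p ≤ 3 / 4)
    (hTn : T ≤ n) (hT : 0.08 * sbar n p q ≤ T) (hT0 : 0 < T) :
    100000 * (p * Real.log n ^ 2) ≤ (p - q) ^ 2 * T := by
  have hd : 0 < p - q := sub_pos.2 hpq
  have hn : (T : ℝ) ≤ n := by exact_mod_cast hTn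
  have hT0' : (0 : ℝ) < T := by exact_mod_cast hT0
  have hL : 0 ≤ Real.log n := Real.log_natCast_nonneg n
  have hx : 0 ≤ p * (1 - q) * n :=
    mul_nonneg (mul_nonneg (by linarith) (by linarith)) (by linarith)
  have h1 : 0.08 * (2 ^ 13 * Real.sqrt (p * (1 - q) * n) * Real.log n) ≤ (p - q) * T := by
    rw [sbar, ← mul_div_assoc, div_le_iff₀ hd] at hT
    linarith
  have h2 : 655 ^ 2 * ((p * (1 - q) * n) * Real.log n ^ 2) ≤ ((p - q) * T) ^ 2 := by
    have h3 := pow_le_pow_left₀ (by positivity) h1 2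
    simp only [mul_pow, Real.sq_sqrt hx] at h3
    have : 0 ≤ (p * (1 - q) * n) * Real.log n ^ 2 := by positivity
    nlinarith
  have h4 : p * (1 / 4) * T ≤ p * (1 - q) * n := by
    have : p * (1 / 4) ≤ p * (1 - q) := by
      apply mul_le_mul_of_nonneg_left <;> linarith
    apply mul_le_mul this hn hT0'.le
    linarith [hq.trans hpq]
  have h5 := mul_le_mul_of_nonneg_right h4 (sq_nonneg (Real.log n))
  have h6 : 0 ≤ p * T * Real.log n ^ 2 :=
    mul_nonneg (mul_nonneg (by linarith) hT0'.le) (sq_nonneg _)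
  refine le_of_mul_le_mul_right ?_ hT0'
  nlinarith

/-- Let `W ⊆ V` be fixed, `s′ ≥ 0.48·s̄`, and `T₁ = V_i ∩ W` for some cluster
`V_i` with `|T₁| ≥ s′/6`. Then with probability at least `1 − n^{−8}`: every `u ∈ T₁` satisfies
`N_{T₁}(u) ≥ (0.9p + 0.1q)|T₁|`, and every `u ∈ W ∖ T₁` satisfies
`N_{T₁}(u) ≤ (0.9p + 0.1q)|T₁|`. -/
theorem statement_12
    (n k : ℕ) (c : Fin n → Fin k) (p q s' : ℝ)
    (hq : 0 < q) (hpq : q < p) (hp : p ≤ 3 / 4) (hpn : 1 ≤ p * n)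
    (W : Finset (Fin n)) (i : Fin k)
    (hs' : 0.48 * sbar n p q ≤ s')
    (hT₁ : s' / 6 ≤ (((clusterF c i ∩ W).card : ℝ))) :
    ENNReal.ofReal (1 - 1 / (n : ℝ) ^ 8) ≤
      sbm n k c p q
        {G |
          (∀ u ∈ clusterF c i ∩ W,
            (0.9 * p + 0.1 * q) * (((clusterF c i ∩ W).card : ℝ)) ≤
              (nbr G (clusterF c i ∩ W) u : ℝ)) ∧
          (∀ u ∈ W \ (clusterF c i ∩ W),
            (nbr G (clusterF c i ∩ W) u : ℝ) ≤
              (0.9 * p + 0.1 * q) * (((clusterF c i ∩ W).card : ℝ)))} := by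
  set T := clusterF c i ∩ W with hTdef
  have hp0 : 0 < p := hq.trans hpq
  have hd : 0 < p - q := sub_pos.2 hpq
  have hn2 : 2 ≤ n := by
    by_contra! h
    have : (n : ℝ) ≤ 1 := by exact_mod_cast Nat.le_of_lt_succ h
    nlinarith
  have hn0 : (0 : ℝ) < n := by positivity
  have hL : 0.69 ≤ Real.log n := by
    have h := Real.log_le_log (by norm_num) (show (2 : ℝ) ≤ n by exact_mod_cast hn2)
    linarith [Real.log_two_gt_d9]
  have hT : 0.08 * sbar n p q ≤ T.card := by linarith
  have hT0 : 0 < T.card := by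
    have : 0 < p * (1 - q) * n := mul_pos (mul_pos hp0 (by linarith)) hn0
    have : 0 < sbar n p q := by
      unfold sbar
      positivity
    have : (0 : ℝ) < T.card := by linarith
    exact_mod_cast this
  have hTn : T.card ≤ n := by simpa using Finset.card_le_univ T
  have hD := mul_log_sq_le_of_sbar_le hq hpq hp hTn hT hT0
  set L := Real.log n
  set D := (p - q) ^ 2 * T.card / p with hDdef
  have hD' : 69000 * L ≤ D := by
    rw [hDdef, le_div_iff₀ hp0]
    nlinarith [mul_le_mul_of_nonneg_left hL (show 0 ≤ p * L by positivity)]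
  have hpow : Real.exp (-9 * L) = 1 / (n : ℝ) ^ 9 := by
    rw [neg_mul, Real.exp_neg, one_div]
    congr 1
    rw [← Real.exp_log hn0, ← Real.exp_nat_mul]
    simp [L]
  let r : {e : Fin n × Fin n // e.1 < e.2} → Set.Icc (0 : ℝ) 1 := fun e =>
    ⟨if c e.1.1 = c e.1.2 then p else q, by split_ifs <;> constructor <;> linarith⟩
  have hsbm : sbm n k c p q = Measure.pi fun e => bern (r e) := rfl
  have hprob : IsProbabilityMeasure (sbm n k c p q) := by
    rw [hsbm]
    have (e : {e : Fin n × Fin n // e.1 < e.2}) : IsProbabilityMeasure (bern (r e)) :=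
      isProbabilityMeasure_bern_s12 (r e).2.1 (r e).2.2
    infer_instance
  set a := (0.9 * p + 0.1 * q) * (T.card : ℝ) with ha
  have hx0 : 0 ≤ (p - q) / p := by positivity
  have hx1 : (p - q) / p ≤ 1 := by
    rw [div_le_one hp0]
    linarith
  have hin (u : Fin n) (hu : u ∈ T) :
      (sbm n k c p q).real {G | (nbr G T u : ℝ) ≤ a} ≤ 1 / (n : ℝ) ^ 9 := by
    simp only [nbr_eq_card_filter_edgesTo]
    rw [hsbm, ← hpow]
    refine (measureReal_card_filter_le_le r (edgesTo T u) p ?_ hp0.le a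
      (t := 0.05 * ((p - q) / p)) (by positivity) (by linarith)).trans ?_
    · intro e he
      simp only [edgesTo, hTdef, clusterF, Finset.mem_filter, Finset.mem_univ, true_and,
        Finset.mem_inter] at he hu
      simp only [r]
      grind
    · rw [card_edgesTo, Finset.card_erase_of_mem hu, Nat.cast_sub hT0, Real.exp_le_exp]
      have h : 0.05 * ((p - q) / p) * a + ((T.card : ℝ) - (1 : ℕ)) *
          (p * (-(0.05 * ((p - q) / p)) + (0.05 * ((p - q) / p)) ^ 2)) =
          -0.0025 * D + 0.05 * (p - q) - 0.0025 * ((p - q) ^ 2 / p) := by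
        rw [ha, hDdef]
        field_simp
        push_cast
        ring
      rw [h]
      have : 0 ≤ (p - q) ^ 2 / p := by positivity
      linarith
  have hout (u : Fin n) (hu : u ∈ W \ T) :
      (sbm n k c p q).real {G | a ≤ (nbr G T u : ℝ)} ≤ 1 / (n : ℝ) ^ 9 := by
    simp only [nbr_eq_card_filter_edgesTo]
    rw [hsbm, ← hpow]
    refine (measureReal_le_card_filter_le r (edgesTo T u) q ?_ hq.le a
      (t := 0.45 * ((p - q) / p)) (by positivity) (by linarith)).trans ?_
    · intro e he
      simp only [edgesTo, hTdef, clusterF, Finset.mem_filter, Finset.mem_univ, true_and,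
        Finset.mem_inter, Finset.mem_sdiff] at he hu
      simp only [r]
      grind
    · rw [card_edgesTo, Finset.erase_eq_of_notMem (Finset.mem_sdiff.1 hu).2, Real.exp_le_exp]
      have h : -(0.45 * ((p - q) / p)) * a + (T.card : ℝ) *
          (q * (0.45 * ((p - q) / p) + (0.45 * ((p - q) / p)) ^ 2)) =
          -0.2025 * D - 0.2025 * (D * ((p - q) / p)) := by
        rw [ha, hDdef]
        field_simp
        ring
      rw [h]
      have : 0 ≤ D * ((p - q) / p) := by positivity
      linarith
  set good : Set ({e : Fin n × Fin n // e.1 < e.2} → Bool) :=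
    {G | (∀ u ∈ T, a ≤ (nbr G T u : ℝ)) ∧ ∀ u ∈ W \ T, (nbr G T u : ℝ) ≤ a}
  have hsub : goodᶜ ⊆ ⋃ u ∈ W, if u ∈ T then {G | (nbr G T u : ℝ) ≤ a}
      else {G | a ≤ (nbr G T u : ℝ)} := by
    intro G hG
    simp only [Set.mem_iUnion]
    by_contra! h
    refine hG ⟨fun u hu => ?_, fun u hu => ?_⟩
    · have := h u (Finset.mem_inter.1 hu).2
      rw [if_pos hu] at this
      exact (not_le.1 this).le
    · have := h u (Finset.mem_sdiff.1 hu).1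
      rw [if_neg (Finset.mem_sdiff.1 hu).2] at this
      exact (not_le.1 this).le
  have hbad : (sbm n k c p q).real goodᶜ ≤ 1 / (n : ℝ) ^ 8 := by
    calc _ ≤ _ := measureReal_mono hsub (measure_ne_top _ _)
      _ ≤ _ := measureReal_biUnion_finset_le _ _
      _ ≤ ∑ u ∈ W, 1 / (n : ℝ) ^ 9 := by
          refine Finset.sum_le_sum fun u hu => ?_
          split_ifs with huT
          · exact hin u huT
          · exact hout u (Finset.mem_sdiff.2 ⟨hu, huT⟩)
      _ ≤ n * (1 / (n : ℝ) ^ 9) := by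
          rw [Finset.sum_const, nsmul_eq_mul]
          gcongr
          simpa using Finset.card_le_univ W
      _ = _ := by field_simp
  refine ENNReal.ofReal_le_of_le_toReal ?_
  change _ ≤ (sbm n k c p q).real good
  rw [probReal_compl_eq_one_sub (Set.toFinite good).measurableSet] at hbad
  linarith
end

section
/- Let V be a set with |V| = n, let δ ∈ (0,1) and C > 1 be constants, and let V_i ⊆ V with |V_i| = s ≥ C·√n·log² n/δ. Let T be a multiset of m = ⌈16·C²·n²·log² n/(δ²·s²)⌉ vertices sampled independently and uniformly at random from V. Then with probability at least 1 − n^{−8}, the number of sampled vertices landing in V_i is at least m·s/(2n); moreover this quantity is at least C·√m·log m/(4δ) and at least C·log n/δ². -/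
open MeasureTheory

/-- The uniform measure on `Fin n` (normalized counting measure). -/
noncomputable def unif (n : ℕ) : Measure (Fin n) :=
  ((n : ENNReal))⁻¹ • Measure.count

lemma unif_singleton (n : ℕ) (x : Fin n) : unif n {x} = (n : ENNReal)⁻¹ := by
  simp [unif]

instance isFiniteMeasure_unif (n : ℕ) : IsFiniteMeasure (unif n) := by
  refine ⟨?_⟩
  rcases Nat.eq_zero_or_pos n with rfl | hn
  · simp [unif]
  · have : (n : ENNReal) ≠ 0 := by exact_mod_cast hn.ne'
    simp [unif, Measure.smul_apply, ENNReal.inv_mul_cancel this]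

lemma pi_unif_apply (n m : ℕ) (S : Finset (Fin m → Fin n)) :
    Measure.pi (fun _ : Fin m => unif n) (S : Set (Fin m → Fin n)) =
      S.card * ((n : ENNReal)⁻¹) ^ m := by
  rw [← sum_measure_singleton]
  simp [Measure.pi_singleton, unif_singleton]

lemma ofReal_le_pi_unif (n m : ℕ) (hn : 0 < n) (P : (Fin m → Fin n) → Prop) [DecidablePred P]
    (ε : ℝ) (h : ((Finset.univ.filter fun X => ¬ P X).card : ℝ) ≤ ε * (n : ℝ) ^ m) :
    ENNReal.ofReal (1 - ε) ≤ Measure.pi (fun _ : Fin m => unif n) {X | P X} := by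
  have hS : {X | P X} = ((Finset.univ.filter P : Finset (Fin m → Fin n)) : Set _) := by
    ext; simp
  have hcard : ((Finset.univ.filter P).card : ℝ) + (Finset.univ.filter fun X => ¬ P X).card
      = (n : ℝ) ^ m := by
    have := Finset.card_filter_add_card_filter_not (s := (Finset.univ : Finset (Fin m → Fin n))) P
    simp only [Finset.card_univ, Fintype.card_fun, Fintype.card_fin] at this
    exact_mod_cast this
  have hn' : (0 : ℝ) < n := by exact_mod_cast hn
  rw [hS, pi_unif_apply]
  have : ((Finset.univ.filter P).card : ENNReal) * ((n : ENNReal)⁻¹) ^ m =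
      ENNReal.ofReal ((Finset.univ.filter P).card * ((n : ℝ)⁻¹) ^ m) := by
    rw [ENNReal.ofReal_mul (by positivity), ENNReal.ofReal_pow (by positivity),
      ENNReal.ofReal_inv_of_pos hn', ENNReal.ofReal_natCast, ENNReal.ofReal_natCast]
  rw [this]
  apply ENNReal.ofReal_le_ofReal
  rw [inv_pow, ← div_eq_mul_inv, le_div_iff₀ (by positivity)]
  linarith

/-- The moment generating function of the number of samples hitting `A`, as a counting identity. -/
lemma sum_pow_card_hits (n m : ℕ) (A : Finset (Fin n)) (r : ℝ) :
    ∑ X : Fin m → Fin n, r ^ (Finset.univ.filter fun t => X t ∈ A).card =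
      (A.card * r + (n - A.card)) ^ m := by
  have h1 : ∀ X : Fin m → Fin n, r ^ (Finset.univ.filter fun t => X t ∈ A).card =
      ∏ t, if X t ∈ A then r else 1 := by
    intro X
    rw [Finset.prod_ite]
    simp
  have h2 : ∑ v : Fin n, (if v ∈ A then r else 1) = A.card * r + (n - A.card) := by
    rw [Finset.sum_ite, Finset.filter_mem_eq_inter, Finset.univ_inter,
      ← Finset.compl_filter, Finset.filter_mem_eq_inter, Finset.univ_inter]
    simp [Finset.card_compl, Nat.cast_sub (show A.card ≤ n by simpa using A.card_le_univ)]
  simp_rw [h1, ← h2]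
  rw [Finset.sum_pow', Fintype.piFinset_univ]

lemma card_few_hits_le (n m : ℕ) (hn : 0 < n) (A : Finset (Fin n)) :
    ((Finset.univ.filter fun X : Fin m → Fin n => ¬ ((m : ℝ) * A.card / (2 * n) ≤
      ((Finset.univ.filter fun t => X t ∈ A).card : ℝ))).card : ℝ) ≤
      Real.exp (-(m * A.card / (8 * n))) * (n : ℝ) ^ m := by
  have hn' : (0 : ℝ) < n := by exact_mod_cast hn
  have hAn : (A.card : ℝ) ≤ n := by
    exact_mod_cast (show A.card ≤ n by simpa using A.card_le_univ)
  set q : ℝ := (m : ℝ) * A.card / (2 * n) with hq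
  have hq0 : 0 ≤ q := by positivity
  have h1 : ((Finset.univ.filter fun X : Fin m → Fin n => ¬ (q ≤
      ((Finset.univ.filter fun t => X t ∈ A).card : ℝ))).card : ℝ) * (1 / 2 : ℝ) ^ q ≤
      (n - A.card / 2 : ℝ) ^ m := by
    have h2 := sum_pow_card_hits n m A (1 / 2)
    rw [show (A.card : ℝ) * (1 / 2) + (n - A.card) = n - A.card / 2 by ring] at h2
    rw [← h2, ← nsmul_eq_mul, ← Finset.sum_const]
    refine (Finset.sum_le_sum fun X hX => ?_).trans
      (Finset.sum_le_sum_of_subset_of_nonneg (Finset.filter_subset _ _) fun _ _ _ => by positivity)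
    simp only [Finset.mem_filter, Finset.mem_univ, true_and, not_le] at hX
    rw [← Real.rpow_natCast]
    exact Real.rpow_le_rpow_of_exponent_ge (by norm_num) (by norm_num) hX.le
  have h3 : (n - A.card / 2 : ℝ) ^ m ≤ Real.exp (-q) * (n : ℝ) ^ m := by
    have h4 : (n - A.card / 2 : ℝ) ≤ Real.exp (-(A.card / (2 * n))) * n := by
      have := Real.add_one_le_exp (-((A.card : ℝ) / (2 * n)))
      calc (n - A.card / 2 : ℝ) = (-((A.card : ℝ) / (2 * n)) + 1) * n := by field_simp; ring
        _ ≤ _ := by gcongr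
    calc (n - A.card / 2 : ℝ) ^ m ≤ (Real.exp (-(A.card / (2 * n))) * n) ^ m :=
          pow_le_pow_left₀ (by linarith) h4 m
      _ = _ := by
          rw [mul_pow, ← Real.exp_nat_mul]
          congr 2
          rw [hq]; ring
  have h5 : (1 / 2 : ℝ) ^ q = Real.exp (-(Real.log 2 * q)) := by
    rw [Real.rpow_def_of_pos (by norm_num)]
    simp
  rw [h5] at h1
  have h6 : Real.exp (-q) ≤ Real.exp (-(m * A.card / (8 * n))) * Real.exp (-(Real.log 2 * q)) := by
    rw [← Real.exp_add, Real.exp_le_exp]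
    have h7 : (m : ℝ) * A.card / (8 * n) = q / 4 := by rw [hq]; field_simp; ring
    rw [h7]
    nlinarith [Real.log_two_lt_d9]
  refine le_of_mul_le_mul_right (h1.trans (h3.trans ?_)) (Real.exp_pos (-(Real.log 2 * q)))
  calc _ ≤ (Real.exp (-(m * A.card / (8 * n))) * Real.exp (-(Real.log 2 * q))) * (n : ℝ) ^ m := by
        gcongr
    _ = _ := by ring

lemma sum_choose_quarter_le (m : ℕ) (h1 : 31 ≤ m) (h2 : m ≤ 67) :
    256 * ∑ j ∈ Finset.range ((m + 3) / 4), m.choose j ≤ 2 ^ m := by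
  have h : ∀ m ∈ Finset.Icc 31 67,
      256 * ∑ j ∈ Finset.range ((m + 3) / 4), m.choose j ≤ 2 ^ m := by
    simp_rw [Nat.choose_eq_descFactorial_div_factorial]
    decide +kernel
  exact h m (Finset.mem_Icc.mpr ⟨h1, h2⟩)

lemma card_filter_two_le (m K : ℕ) (v : Fin 2) :
    (Finset.univ.filter fun X : Fin m → Fin 2 =>
      (Finset.univ.filter fun t => X t ∈ ({v} : Finset (Fin 2))).card < K).card ≤
      ∑ j ∈ Finset.range K, m.choose j := by
  classical
  have hsub : ((Finset.univ.filter fun X : Fin m → Fin 2 =>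
      (Finset.univ.filter fun t => X t ∈ ({v} : Finset (Fin 2))).card < K).image
      fun X => Finset.univ.filter fun t => X t ∈ ({v} : Finset (Fin 2))) ⊆
      (Finset.range K).biUnion fun j => Finset.powersetCard j Finset.univ := by
    intro B hB
    simp only [Finset.mem_image, Finset.mem_filter, Finset.mem_univ, true_and] at hB
    obtain ⟨X, hX, rfl⟩ := hB
    simpa [Finset.mem_powersetCard] using hX
  have hinj : Function.Injective fun X : Fin m → Fin 2 =>
      Finset.univ.filter fun t => X t ∈ ({v} : Finset (Fin 2)) := by
    intro X Y hXY
    ext1 t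
    have := congrArg (fun B => t ∈ B) hXY
    simp only [Finset.mem_filter, Finset.mem_univ, true_and, Finset.mem_singleton, eq_iff_iff]
      at this
    omega
  rw [← Finset.card_image_of_injective _ hinj]
  refine (Finset.card_le_card hsub).trans (Finset.card_biUnion_le.trans (le_of_eq ?_))
  simp

lemma div_le_log_of_pow_le {k p q n : ℕ} (hq : 0 < q) (hk : 0 < k)
    (hpk : (2.7182818286 : ℝ) ^ p ≤ (k : ℝ) ^ q) (hkn : k ≤ n) : (p / q : ℝ) ≤ Real.log n := by
  have hk' : (0 : ℝ) < k := by exact_mod_cast hk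
  have hq' : (0 : ℝ) < q := by exact_mod_cast hq
  have hle : Real.log k ≤ Real.log n := Real.log_le_log hk' (by exact_mod_cast hkn)
  refine le_trans ?_ hle
  rw [div_le_iff₀ hq', mul_comm, ← Real.log_pow, Real.le_log_iff_exp_le (by positivity)]
  calc Real.exp p = Real.exp 1 ^ p := by rw [← Real.exp_nat_mul, mul_one]
    _ ≤ 2.7182818286 ^ p := by gcongr; exact Real.exp_one_lt_d9.le
    _ ≤ _ := hpk

lemma four_le_log_of_log_pow_four_le (n : ℕ) (hn : 5 ≤ n) (h : Real.log n ^ 4 ≤ n) :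
    4 ≤ Real.log n := by
  have step : ∀ (k p q j : ℕ), 0 < q → 0 < k → (2.7182818286 : ℝ) ^ p ≤ (k : ℝ) ^ q →
      (j : ℝ) < (p / q : ℝ) ^ 4 → k ≤ n → j + 1 ≤ n := by
    intro k p q j hq hk hpk hj hkn
    have : (p / q : ℝ) ^ 4 ≤ Real.log n ^ 4 := by
      gcongr
      exact div_le_log_of_pow_le hq hk hpk hkn
    exact_mod_cast (hj.trans_le (this.trans h))
  have h7 := step 5 8 5 6 (by norm_num) (by norm_num) (by norm_num) (by norm_num) hn
  have h14 := step 7 19 10 13 (by norm_num) (by norm_num) (by norm_num) (by norm_num) h7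
  have h46 := step 14 13 5 45 (by norm_num) (by norm_num) (by norm_num) (by norm_num) h14
  have h150 := step 46 7 2 149 (by norm_num) (by norm_num) (by norm_num) (by norm_num) h46
  have h4 := div_le_log_of_pow_le (k := 150) (p := 4) (q := 1) (n := n) (by norm_num) (by norm_num)
    (by norm_num) h150
  simpa using h4

lemma ofReal_le_pi_unif_two (m : ℕ) (A : Finset (Fin 2)) (hA : A.card = 1)
    (h1 : 31 ≤ m) (h2 : m ≤ 67) :
    ENNReal.ofReal (1 - 1 / ((2 : ℕ) : ℝ) ^ 8) ≤
      Measure.pi (fun _ : Fin m => unif 2)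
        {X | (m : ℝ) * (A.card : ℝ) / (2 * (2 : ℕ)) ≤
          ((Finset.univ.filter fun t : Fin m => X t ∈ A).card : ℝ)} := by
  obtain ⟨v, rfl⟩ := Finset.card_eq_one.mp hA
  apply ofReal_le_pi_unif _ _ (by norm_num)
  have h3 := (Nat.mul_le_mul_left 256 (card_filter_two_le m ((m + 3) / 4) v)).trans
    (sum_choose_quarter_le m h1 h2)
  have h4 : (Finset.univ.filter fun X : Fin m → Fin 2 =>
      ¬ ((m : ℝ) * (({v} : Finset (Fin 2)).card : ℝ) / (2 * (2 : ℕ)) ≤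
        ((Finset.univ.filter fun t : Fin m => X t ∈ ({v} : Finset (Fin 2))).card : ℝ))) ⊆
      Finset.univ.filter fun X : Fin m → Fin 2 =>
        (Finset.univ.filter fun t => X t ∈ ({v} : Finset (Fin 2))).card < (m + 3) / 4 := by
    refine Finset.monotone_filter_right _ ?_
    intro X _ hX
    rw [not_le, Finset.card_singleton, lt_div_iff₀ (by norm_num)] at hX
    have hX' : (Finset.univ.filter fun t => X t ∈ ({v} : Finset (Fin 2))).card * 4 < m := by
      have h5 : ((Finset.univ.filter fun t => X t ∈ ({v} : Finset (Fin 2))).card : ℝ) * 4 < m := by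
        push_cast at hX
        linarith
      exact_mod_cast h5
    omega
  have h5 := (Nat.mul_le_mul_left 256 (Finset.card_le_card h4)).trans h3
  rw [one_div, ← div_eq_inv_mul, le_div_iff₀ (by positivity), mul_comm]
  norm_num only
  exact_mod_cast h5

/-- Away from `n = 2`, the size constraint on `s < n` forces `n` to be large. -/
lemma four_le_log_of_constraint (n s : ℕ) (hn : 3 ≤ n) (hsn : s < n)
    (h : (n : ℝ) * Real.log n ^ 4 ≤ (s : ℝ) ^ 2) : 4 ≤ Real.log n := by
  have hs1 : (s : ℝ) + 1 ≤ n := by exact_mod_cast hsn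
  have hs0 : (0 : ℝ) ≤ s := by positivity
  obtain rfl | rfl | hn5 : n = 3 ∨ n = 4 ∨ 5 ≤ n := by omega
  · have h1 : (1.08 : ℝ) ≤ Real.log (3 : ℕ) := by
      have := div_le_log_of_pow_le (k := 3) (p := 27) (q := 25) (n := 3) (by norm_num) (by norm_num)
        (by norm_num) le_rfl
      norm_num at this ⊢
      exact this
    have h2 : (1.08 : ℝ) ^ 4 ≤ Real.log (3 : ℕ) ^ 4 := by gcongr
    push_cast at *
    nlinarith
  · have h1 : (1.25 : ℝ) ≤ Real.log (4 : ℕ) := by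
      have := div_le_log_of_pow_le (k := 4) (p := 5) (q := 4) (n := 4) (by norm_num) (by norm_num)
        (by norm_num) le_rfl
      norm_num at this ⊢
      exact this
    have h2 : (1.25 : ℝ) ^ 4 ≤ Real.log (4 : ℕ) ^ 4 := by gcongr
    push_cast at *
    nlinarith
  · refine four_le_log_of_log_pow_four_le n hn5 ?_
    have hn' : (0 : ℝ) < n := by positivity
    refine le_of_mul_le_mul_left (h.trans ?_) hn'
    nlinarith

/-- Let `|V| = n`, `δ ∈ (0,1)`, `C > 1`, and `V_i ⊆ V` with
`|V_i| = s ≥ C√n·log²n/δ`. Let `T` consist of `m = ⌈16C²n²log²n/(δ²s²)⌉` i.i.d. uniform samples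
from `V`. Then with probability at least `1 − n^{−8}` the number of samples landing in `V_i` is at
least `m·s/(2n)`; moreover `m·s/(2n) ≥ C√m·log m/(4δ)` and `m·s/(2n) ≥ C·log n/δ²`. -/
theorem statement_14 (n : ℕ) (δ C : ℝ) (hδ0 : 0 < δ) (hδ1 : δ < 1) (hC : 1 < C)
    (Vi : Finset (Fin n)) (s : ℕ) (hsdef : s = Vi.card)
    (hs : C * Real.sqrt n * (Real.log n) ^ 2 / δ ≤ (s : ℝ))
    (m : ℕ) (hmdef : m = ⌈16 * C ^ 2 * (n : ℝ) ^ 2 * (Real.log n) ^ 2 / (δ ^ 2 * (s : ℝ) ^ 2)⌉₊) :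
    ENNReal.ofReal (1 - 1 / (n : ℝ) ^ 8) ≤
      Measure.pi (fun _ : Fin m => unif n)
        {X | (m : ℝ) * s / (2 * n) ≤
          ((Finset.univ.filter fun t : Fin m => X t ∈ Vi).card : ℝ)} ∧
    C * Real.sqrt m * Real.log m / (4 * δ) ≤ (m : ℝ) * s / (2 * n) ∧
    C * Real.log n / δ ^ 2 ≤ (m : ℝ) * s / (2 * n) := by
  subst hsdef
  rcases Nat.lt_or_ge n 2 with hn | hn
  · have hL : Real.log n = 0 := by interval_cases n <;> simp
    have hm : m = 0 := by rw [hmdef, hL]; simp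
    subst hm
    rw [Measure.pi_of_empty]
    simp [hL]
  set L := Real.log n with hLdef
  set s : ℝ := (Vi.card : ℝ) with hsdef
  have hn2 : (2 : ℝ) ≤ n := by exact_mod_cast hn
  have hn0 : (0 : ℝ) < n := by linarith
  have hC0 : 0 < C := by linarith
  have hLlog2 : Real.log 2 ≤ L := Real.log_le_log (by norm_num) hn2
  have hL69 : 0.6931471803 ≤ L := Real.log_two_gt_d9.le.trans hLlog2
  have hL0 : 0 < L := by linarith
  have hsn : s ≤ n := by
    exact Nat.cast_le.mpr (show Vi.card ≤ n by simpa using Vi.card_le_univ)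
  have hs0 : 0 < s := lt_of_lt_of_le (by positivity) hs
  have hs2 : C ^ 2 * n * L ^ 4 ≤ δ ^ 2 * s ^ 2 := by
    rw [div_le_iff₀ hδ0] at hs
    have := pow_le_pow_left₀ (by positivity) hs 2
    calc C ^ 2 * n * L ^ 4 = (C * Real.sqrt n * L ^ 2) ^ 2 := by
          rw [mul_pow, mul_pow, Real.sq_sqrt hn0.le]; ring
      _ ≤ _ := this
      _ = _ := by ring
  have hMle : 16 * C ^ 2 * (n : ℝ) ^ 2 * L ^ 2 / (δ ^ 2 * s ^ 2) ≤ m := hmdef ▸ Nat.le_ceil _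
  have hltM : (m : ℝ) < 16 * C ^ 2 * (n : ℝ) ^ 2 * L ^ 2 / (δ ^ 2 * s ^ 2) + 1 :=
    hmdef ▸ Nat.ceil_lt_add_one (by positivity)
  have hMn : 16 * C ^ 2 * (n : ℝ) ^ 2 * L ^ 2 / (δ ^ 2 * s ^ 2) ≤ 16 * n / L ^ 2 := by
    rw [div_le_div_iff₀ (by positivity) (by positivity)]
    calc _ = 16 * n * (C ^ 2 * n * L ^ 4) := by ring
      _ ≤ _ := by gcongr
  have hLsq : 0.48045 ≤ L ^ 2 := by nlinarith
  have hm34 : (m : ℝ) < 33.31 * n + 1 := by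
    have : 16 * n / L ^ 2 ≤ 33.31 * n := by
      rw [div_le_iff₀ (by positivity)]
      nlinarith
    linarith
  have hm0 : (0 : ℝ) < m := lt_of_lt_of_le (by positivity) hMle
  have hmean : 8 * C ^ 2 * L ^ 2 / δ ^ 2 ≤ m * s / (2 * n) := by
    rw [div_le_iff₀ (by positivity)] at hMle
    rw [div_le_div_iff₀ (by positivity) (by positivity)]
    refine le_of_mul_le_mul_right ?_ hs0
    calc 8 * C ^ 2 * L ^ 2 * (2 * n) * s ≤ 8 * C ^ 2 * L ^ 2 * (2 * n) * n := by gcongr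
      _ = 16 * C ^ 2 * (n : ℝ) ^ 2 * L ^ 2 := by ring
      _ ≤ _ := hMle
      _ = _ := by ring
  refine ⟨?_, ?_, ?_⟩
  · rcases (Nat.cast_le.mp hsn).eq_or_lt with hcard | hcard
    · have hVi : Vi = Finset.univ := by
        rw [← Finset.card_eq_iff_eq_univ, hcard, Fintype.card_fin]
      apply ofReal_le_pi_unif _ _ (by omega)
      rw [Finset.filter_false_of_mem]
      · simp only [Finset.card_empty, Nat.cast_zero]
        positivity
      · intro X _
        rw [not_not, hsdef, hVi]
        simp only [Finset.mem_univ, Finset.filter_true, Finset.card_univ, Fintype.card_fin]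
        rw [div_le_iff₀ (by positivity)]
        nlinarith
    · have hcon : (n : ℝ) * L ^ 4 ≤ s ^ 2 := by
        have h1 : 1 ≤ C ^ 2 := one_le_pow₀ hC.le
        have h2 : δ ^ 2 ≤ 1 := pow_le_one₀ hδ0.le hδ1.le
        calc (n : ℝ) * L ^ 4 ≤ C ^ 2 * (n * L ^ 4) := le_mul_of_one_le_left (by positivity) h1
          _ = C ^ 2 * n * L ^ 4 := by ring
          _ ≤ _ := hs2
          _ ≤ _ := mul_le_of_le_one_left (by positivity) h2
      rcases hn.eq_or_lt with rfl | hn3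
      · have hcard1 : Vi.card = 1 := by
          have : 0 < Vi.card := Nat.cast_pos.mp hs0
          omega
        refine ofReal_le_pi_unif_two m Vi hcard1 ?_ ?_
        · have h1 : (30.7 : ℝ) ≤ m := by
            refine le_trans ?_ hMle
            have hs1 : s = 1 := by rw [hsdef, hcard1]; simp
            rw [hs1, le_div_iff₀ (by positivity)]
            have h1 : 1 ≤ C ^ 2 := one_le_pow₀ hC.le
            have h2 : δ ^ 2 ≤ 1 := pow_le_one₀ hδ0.le hδ1.le
            push_cast
            nlinarith [mul_nonneg (sub_nonneg.mpr h1) (sub_nonneg.mpr hLsq)]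
          have : (30 : ℝ) < m := by linarith
          exact_mod_cast this
        · have : (m : ℝ) < 68 := by push_cast at hm34; linarith
          have : m < 68 := by exact_mod_cast this
          omega
      · have hL4 : 4 ≤ L := four_le_log_of_constraint n Vi.card hn3 hcard hcon
        apply ofReal_le_pi_unif _ _ (by omega)
        refine (card_few_hits_le n m (by omega) Vi).trans ?_
        gcongr
        rw [one_div, ← Real.rpow_natCast, ← Real.rpow_neg hn0.le, Real.rpow_def_of_pos hn0,
          Real.exp_le_exp]
        have h1 : (m : ℝ) * s / (8 * n) = m * s / (2 * n) / 4 := by field_simp; norm_num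
        have h2 : 8 * L ^ 2 ≤ 8 * C ^ 2 * L ^ 2 / δ ^ 2 := by
          rw [le_div_iff₀ (by positivity)]
          have h1 : 1 ≤ C ^ 2 := one_le_pow₀ hC.le
          have h2 : δ ^ 2 ≤ 1 := pow_le_one₀ hδ0.le hδ1.le
          have h3 : 0 ≤ L ^ 2 := by positivity
          nlinarith
        rw [← hLdef, ← hsdef, h1]
        push_cast
        nlinarith
  · have hlogm : Real.log m ≤ 8 * L := by
      have h1 : (m : ℝ) ≤ (n : ℝ) ^ 8 := by
        have : (2 : ℝ) ^ 7 ≤ (n : ℝ) ^ 7 := by gcongr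
        nlinarith
      calc Real.log m ≤ Real.log ((n : ℝ) ^ 8) := Real.log_le_log hm0 h1
        _ = 8 * L := by rw [Real.log_pow, hLdef]; norm_num
    have hsqrt : 4 * C * n * L ≤ δ * s * Real.sqrt m := by
      rw [div_le_iff₀ (by positivity)] at hMle
      refine (sq_le_sq₀ (by positivity) (by positivity)).mp ?_
      rw [mul_pow, mul_pow _ (Real.sqrt m), Real.sq_sqrt hm0.le]
      linarith
    have hsq : Real.sqrt m * Real.sqrt m = m := Real.mul_self_sqrt hm0.le
    rw [div_le_div_iff₀ (by positivity) (by positivity)]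
    calc C * Real.sqrt m * Real.log m * (2 * n) ≤ C * Real.sqrt m * (8 * L) * (2 * n) := by gcongr
      _ = 4 * Real.sqrt m * (4 * C * n * L) := by ring
      _ ≤ 4 * Real.sqrt m * (δ * s * Real.sqrt m) := by gcongr
      _ = (Real.sqrt m * Real.sqrt m) * s * (4 * δ) := by ring
      _ = _ := by rw [hsq]
  · refine le_trans ?_ hmean
    refine div_le_div_of_nonneg_right ?_ (by positivity)
    have h1 : L ≤ C * L := le_mul_of_one_le_left hL0.le hC.le
    calc C * L ≤ C * L * (8 * (C * L)) := le_mul_of_one_le_right (by positivity) (by linarith)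
      _ = 8 * C ^ 2 * L ^ 2 := by ring
end
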